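/- Suppose the HNN-extension 𝔼 = ⟨B, t; t⁻¹Ht = K, φ⟩ satisfies condition (*), 𝒞 is a root class of groups closed under taking quotient groups, and the subgroups H and K are finite. Then 𝔼 is residually a 𝒞-group if and only if B is residually a 𝒞-group and 𝔘 ∈ 𝒞 and 𝔙 ∈ 𝒞. -/

import Mathlib

universe u

open Subgroup

/-- A class of groups in universe `u`: a property of groups. -/
abbrev GroupClass : Type (u + 1) := (G : Type u) → [inst : Group G] → Prop

/-- The class is closed under isomorphism. -/
def IsoClosed (C : GroupClass.{u}) : Prop :=
  ∀ (G₁ G₂ : Type u) [Group G₁] [Group G₂], (G₁ ≃* G₂) → C G₁ → C G₂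

/-- The class is closed under taking subgroups. -/
def SubgroupClosed (C : GroupClass.{u}) : Prop :=
  ∀ (G : Type u) [Group G] (H : Subgroup G), C G → C H

/-- The class is closed under taking quotient groups. -/
def QuotClosed (C : GroupClass.{u}) : Prop :=
  ∀ (G : Type u) [Group G] (N : Subgroup G) [N.Normal], C G → C (G ⧸ N)

/-- The class is closed under direct products of a finite number of factors. -/
def FinProdClosed (C : GroupClass.{u}) : Prop :=
  ∀ (ι : Type u) [Finite ι] (G : ι → Type u) [∀ i, Group (G i)],
    (∀ i, C (G i)) → C (∀ i, G i)

/-- Gruenberg's condition. -/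
def Gruenberg (C : GroupClass.{u}) : Prop :=
  ∀ (X : Type u) [Group X] (Y Z : Subgroup X) (_ : Z ≤ Y) (hY : Y.Normal)
    (hZY : (Z.subgroupOf Y).Normal), C (X ⧸ Y) → C (↥Y ⧸ Z.subgroupOf Y) →
    ∃ T : Subgroup X, ∃ _ : T.Normal, T ≤ Z ∧ C (X ⧸ T)

/-- A root class of groups. -/
def IsRootClass (C : GroupClass.{u}) : Prop :=
  IsoClosed C ∧ (∃ (G : Type u) (_ : Group G), C G ∧ Nontrivial G) ∧
    SubgroupClosed C ∧ Gruenberg C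

/-- `X` is residually a `C`-group. -/
def Residually (C : GroupClass.{u}) (X : Type u) [Group X] : Prop :=
  ∀ x : X, x ≠ 1 → ∃ (G : Type u) (_ : Group G) (f : X →* G),
    Function.Surjective f ∧ C G ∧ f x ≠ 1

/-- Every element has finite order. -/
def Periodic (G : Type u) [Group G] : Prop := ∀ g : G, IsOfFinOrder g

/-- The class consists only of periodic groups. -/
def PeriodicClass (C : GroupClass.{u}) : Prop := ∀ (G : Type u) [Group G], C G → Periodic G

/-- `Aut_X(Y)`: the subgroup of `Aut(Y)` consisting of the restrictions to `Y`
of the inner automorphisms of `X` (that leave `Y` invariant; when `Y` is normal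
in `X` these are the restrictions of all inner automorphisms of `X`). -/
def autOf (X : Type u) [Group X] (Y : Subgroup X) : Subgroup (MulAut Y) where
  carrier := { α | ∃ x : X, ∀ y : Y, ((α y : Y) : X) = x * y * x⁻¹ }
  one_mem' := ⟨1, fun y => by simp⟩
  mul_mem' := by
    rintro α β ⟨a, ha⟩ ⟨b, hb⟩
    refine ⟨a * b, fun y => ?_⟩
    have h1 : ((α (β y) : Y) : X) = a * (β y) * a⁻¹ := ha (β y)
    have h2 : ((β y : Y) : X) = b * y * b⁻¹ := hb y
    show ((α (β y) : Y) : X) = _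
    rw [h1, h2]; group
  inv_mem' := by
    rintro α ⟨a, ha⟩
    refine ⟨a⁻¹, fun y => ?_⟩
    have h : ((α (α⁻¹ y) : Y) : X) = a * (α⁻¹ y) * a⁻¹ := ha (α⁻¹ y)
    rw [MulAut.apply_inv_self] at h
    rw [h]; group

/-- Conjugation of automorphism groups along an isomorphism `φ : H ≃* K`,
giving `φ ∘ α ∘ φ⁻¹ : Aut K →* Aut H`. -/
def autConjHom {H K : Type u} [Group H] [Group K] (φ : H ≃* K) : MulAut K →* MulAut H where
  toFun α := (φ.trans α).trans φ.symm
  map_one' := by ext x; simp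
  map_mul' := fun α β => by
    ext x
    simp [MulAut.mul_apply, MulEquiv.trans_apply, MulEquiv.apply_symm_apply]

/-- `N ∈ 𝒞*(X)`: `N` is normal in `X` and `X/N ∈ 𝒞`. -/
def inCStar (C : GroupClass.{u}) (X : Type u) [Group X] (N : Subgroup X) : Prop :=
  ∃ _ : N.Normal, C (X ⧸ N)

/-- `X` is `𝒞`-quasi-regular with respect to its subgroup `Y`. -/
def QuasiRegular (C : GroupClass.{u}) (X : Type u) [Group X] (Y : Subgroup X) : Prop :=
  ∀ M : Subgroup Y, inCStar C Y M → ∃ N : Subgroup X, inCStar C X N ∧ N.subgroupOf Y ≤ M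

/-- `𝔓(𝒞)`: the set of primes dividing the order of some element of some `𝒞`-group. -/
def primesOf (C : GroupClass.{u}) : Set ℕ :=
  { p | p.Prime ∧ ∃ (Z : Type u) (_ : Group Z), C Z ∧ ∃ z : Z, p ∣ orderOf z }

/-- `Y` is `𝔓(𝒞)′`-isolated in `X`. -/
def PIsolated (C : GroupClass.{u}) {X : Type u} [Group X] (Y : Subgroup X) : Prop :=
  ∀ (x : X) (q : ℕ), q.Prime → q ∉ primesOf C → x ^ q ∈ Y → x ∈ Y

/-- Every finitely generated subgroup is cyclic. -/
def LocallyCyclic (G : Type u) [Group G] : Prop :=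
  ∀ S : Subgroup G, S.FG → IsCyclic S

/-- `A` is a `𝒞`-bounded abelian group. -/
def CBoundedAbelian (C : GroupClass.{u}) (A : Type u) [Group A] : Prop :=
  (∀ a b : A, a * b = b * a) ∧
  ∀ (N : Subgroup A), ∀ _ : N.Normal, ∀ p ∈ primesOf C,
    (∃ m : ℕ, 0 < m ∧ ∀ x : A ⧸ N, (∃ n : ℕ, x ^ p ^ n = 1) → x ^ m = 1) ∧
    (∃ (Z : Type u) (_ : Group Z), C Z ∧
      Cardinal.mk {x : A ⧸ N // ∃ n : ℕ, x ^ p ^ n = 1} ≤ Cardinal.mk Z)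

/-- `X` is a `𝒞`-bounded nilpotent group: it has a finite central series with
`𝒞`-bounded abelian factors. -/
def CBoundedNilpotent (C : GroupClass.{u}) (X : Type u) [Group X] : Prop :=
  ∃ (n : ℕ) (S : ℕ → Subgroup X), S 0 = ⊥ ∧ S n = ⊤ ∧
    (∀ i < n, S i ≤ S (i + 1)) ∧ (∀ i < n, (S i).Normal) ∧
    (∀ i < n, ∀ x ∈ S (i + 1), ∀ g : X, g⁻¹ * x⁻¹ * g * x ∈ S i) ∧
    (∀ i < n, ∀ _ : ((S i).subgroupOf (S (i + 1))).Normal,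
      CBoundedAbelian C (↥(S (i + 1)) ⧸ (S i).subgroupOf (S (i + 1))))

/-- `A` is a normal subgroup of `U` (as subgroups of a common group). -/
def NormalIn {G : Type u} [Group G] (A U : Subgroup G) : Prop := (A.subgroupOf U).Normal

/-- `G` satisfies a non-trivial identity. -/
def SatisfiesNontrivialIdentity (G : Type u) [Group G] : Prop :=
  ∃ w : FreeGroup ℕ, w ≠ 1 ∧ ∀ f : FreeGroup ℕ →* G, f w = 1

section HNN

variable {B : Type u} [Group B] (H K : Subgroup B) (φ : H ≃* K)

/-- `𝔎 = φ ∘ Aut_B(K) ∘ φ⁻¹`, as a subgroup of `Aut(H)`. -/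
def frakK : Subgroup (MulAut H) := (autOf B K).map (autConjHom φ)

/-- `𝔘 = ⟨𝔥, 𝔎⟩ ≤ Aut(H)`. -/
def frakU : Subgroup (MulAut H) := autOf B H ⊔ frakK H K φ

/-- `𝔙 = ⟨𝔏, 𝔉⟩ ≤ Aut(L)`, where `ψ = φ|_L`. -/
def frakV (ψ : MulAut ↥(H ⊓ K)) : Subgroup (MulAut ↥(H ⊓ K)) :=
  autOf B (H ⊓ K) ⊔ Subgroup.zpowers ψ

/-- `ψ` is the restriction of `φ` to `L = H ⊓ K` (this encodes the
`φ`-invariance of `L` from condition (*)). -/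
def IsRestrictionToL (ψ : MulAut ↥(H ⊓ K)) : Prop :=
  ∀ x : ↥(H ⊓ K), ((ψ x : ↥(H ⊓ K)) : B) = ((φ ⟨(x : B), x.2.1⟩ : K) : B)

/-- `(H ⊓ K)φ = H ⊓ K` : the `φ`-invariance of `L` from condition (*). -/
def PhiInvL : Prop :=
  ((H ⊓ K).subgroupOf H).map φ.toMonoidHom = (H ⊓ K).subgroupOf K

end HNN

section HNNExtra

variable (C : GroupClass.{u}) {B : Type u} [Group B] (H K : Subgroup B) (φ : H ≃* K)

/-- Condition (†): at least one of `𝔥` and `𝔎` is normal in `𝔘`, or `𝔘 ∈ 𝒞`. -/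
def CondDag : Prop :=
  NormalIn (autOf B H) (frakU H K φ) ∨ NormalIn (frakK H K φ) (frakU H K φ) ∨
    C ↥(frakU H K φ)

/-- Condition (‡): at least one of `𝔏` and `𝔉` is normal in `𝔙`, or `𝔙 ∈ 𝒞`. -/
def CondDDag (ψ : MulAut ↥(H ⊓ K)) : Prop :=
  NormalIn (autOf B (H ⊓ K)) (frakV H K ψ) ∨
    NormalIn (Subgroup.zpowers ψ) (frakV H K ψ) ∨ C ↥(frakV H K ψ)

/-- `Q` is a pre-`𝒞`-admissible subgroup of `B`: it is normal, `(H,K,φ)`-compatible,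
`B/Q ∈ 𝒞`, and `HQ/Q ∩ KQ/Q = LQ/Q`. -/
def PreAdmissible (Q : Subgroup B) : Prop :=
  ∃ _ : Q.Normal, ((Q ⊓ H).subgroupOf H).map φ.toMonoidHom = (Q ⊓ K).subgroupOf K ∧
    C (B ⧸ Q) ∧
    (H.map (QuotientGroup.mk' Q)) ⊓ (K.map (QuotientGroup.mk' Q)) =
      (H ⊓ K).map (QuotientGroup.mk' Q)

end HNNExtra


section ClassClosure

variable {C : GroupClass.{u}}

theorem IsRootClass.of_injective (hC : IsRootClass C) {X G : Type u} [Group X] [Group G]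
    (f : X →* G) (hf : Function.Injective f) (hG : C G) : C X :=
  hC.1 _ _ (MonoidHom.ofInjective hf).symm (hC.2.2.1 G f.range hG)

theorem IsRootClass.of_surjective (hC : IsRootClass C) (hquot : QuotClosed C)
    {X G : Type u} [Group X] [Group G] (f : X →* G) (hf : Function.Surjective f) (hX : C X) :
    C G :=
  hC.1 _ _ (QuotientGroup.quotientKerEquivOfSurjective f hf) (hquot X f.ker hX)

theorem IsRootClass.quotient_ker (hC : IsRootClass C) {X G : Type u} [Group X] [Group G]
    (f : X →* G) (hG : C G) : C (X ⧸ f.ker) :=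
  hC.of_injective (QuotientGroup.kerLift f) (QuotientGroup.kerLift_injective f) hG

theorem IsRootClass.inCStar_ker (hC : IsRootClass C) {X G : Type u} [Group X] [Group G]
    (f : X →* G) (hG : C G) : inCStar C X f.ker :=
  ⟨inferInstance, hC.quotient_ker f hG⟩

/-- Gruenberg's condition, phrased through homomorphisms. -/
theorem IsRootClass.exists_le_ker (hC : IsRootClass C) {X G M : Type u} [Group X] [Group G]
    [Group M] (f : X →* G) (ρ : f.ker →* M) (hG : C G) (hM : C M) :
    ∃ T : Subgroup X, inCStar C X T ∧ T ≤ f.ker ∧ ∀ x (hx : x ∈ f.ker), x ∈ T → ρ ⟨x, hx⟩ = 1 := by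
  have hle : ρ.ker.map f.ker.subtype ≤ f.ker := Subgroup.map_subtype_le _
  have hsub : (ρ.ker.map f.ker.subtype).subgroupOf f.ker = ρ.ker :=
    Subgroup.comap_map_eq_self_of_injective f.ker.subtype_injective _
  have hnormal : ((ρ.ker.map f.ker.subtype).subgroupOf f.ker).Normal := by
    rw [hsub]; infer_instance
  obtain ⟨T, hT, hTle, hCT⟩ := hC.2.2.2 X f.ker (ρ.ker.map f.ker.subtype) hle inferInstance
    hnormal (hC.quotient_ker f hG)
    (hC.1 _ _ (QuotientGroup.quotientMulEquivOfEq hsub.symm) (hC.quotient_ker ρ hM))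
  refine ⟨T, ⟨hT, hCT⟩, hTle.trans hle, fun x hx hxT => ?_⟩
  obtain ⟨y, hy, hyx⟩ := hTle hxT
  have : y = ⟨x, hx⟩ := Subtype.ext hyx
  rw [← this]
  exact hy

theorem IsRootClass.extension (hC : IsRootClass C) {X G M : Type u} [Group X] [Group G]
    [Group M] (f : X →* G) (ρ : f.ker →* M) (hρ : Function.Injective ρ) (hG : C G) (hM : C M) :
    C X := by
  obtain ⟨T, ⟨hT, hCT⟩, hTf, hTρ⟩ := hC.exists_le_ker f ρ hG hM
  have hbot : T = ⊥ := by
    refine (Subgroup.eq_bot_iff_forall _).2 fun x hx => ?_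
    have h := hTρ x (hTf hx) hx
    rw [← map_one ρ] at h
    exact congrArg Subtype.val (hρ h)
  subst hbot
  exact hC.1 _ _ QuotientGroup.quotientBot hCT

theorem IsRootClass.prod (hC : IsRootClass C) {G M : Type u} [Group G] [Group M]
    (hG : C G) (hM : C M) : C (G × M) := by
  refine hC.extension (MonoidHom.fst G M) ((MonoidHom.snd G M).comp (Subgroup.subtype _)) ?_ hG hM
  rintro ⟨⟨a, b⟩, h⟩ ⟨⟨c, d⟩, h'⟩ e
  have h1 : a = 1 := h
  have h2 : c = 1 := h'
  have h3 : b = d := e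
  simp [h1, h2, h3]

theorem IsRootClass.semidirectProduct (hC : IsRootClass C) {A V : Type u} [Group A] [Group V]
    (θ : V →* MulAut A) (hA : C A) (hV : C V) : C (A ⋊[θ] V) := by
  have key : ∀ x : (SemidirectProduct.rightHom : A ⋊[θ] V →* V).ker, x.1.right = 1 := fun x => x.2
  refine hC.extension (SemidirectProduct.rightHom : A ⋊[θ] V →* V)
    { toFun := fun x => x.1.left, map_one' := rfl, map_mul' := fun x y => ?_ } ?_ hV hA
  · simp [key x]
  · intro x y h
    exact Subtype.ext (SemidirectProduct.ext h ((key x).trans (key y).symm))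

theorem inCStar.inf (hC : IsRootClass C) {X : Type u} [Group X] {N₁ N₂ : Subgroup X}
    (h₁ : inCStar C X N₁) (h₂ : inCStar C X N₂) : inCStar C X (N₁ ⊓ N₂) := by
  obtain ⟨hn₁, hC₁⟩ := h₁
  obtain ⟨hn₂, hC₂⟩ := h₂
  have h := hC.inCStar_ker ((QuotientGroup.mk' N₁).prod (QuotientGroup.mk' N₂)) (hC.prod hC₁ hC₂)
  rwa [MonoidHom.ker_prod, QuotientGroup.ker_mk', QuotientGroup.ker_mk'] at h

theorem IsRootClass.exists_mem_ne_one (hC : IsRootClass C) :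
    ∃ (Z : Type u) (_ : Group Z) (z : Z), C Z ∧ z ≠ 1 := by
  obtain ⟨Z, iZ, hZ, hnt⟩ := hC.2.1
  obtain ⟨z, hz⟩ := exists_ne (1 : Z)
  exact ⟨Z, iZ, z, hZ, hz⟩

theorem IsRootClass.inCStar_top (hC : IsRootClass C) (X : Type u) [Group X] :
    inCStar C X ⊤ := by
  obtain ⟨Z, _, _, hZ, _⟩ := hC.exists_mem_ne_one
  have h := hC.inCStar_ker (1 : X →* Z) hZ
  rwa [MonoidHom.ker_one] at h

theorem IsRootClass.exists_le_of_finite (hC : IsRootClass C) {X : Type u} {ι : Type*} [Group X]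
    (S : Set ι) (hS : S.Finite) (P : ι → Subgroup X)
    (hP : ∀ i ∈ S, inCStar C X (P i)) :
    ∃ N, inCStar C X N ∧ ∀ i ∈ S, N ≤ P i := by
  induction S, hS using Set.Finite.induction_on with
  | empty => exact ⟨⊤, hC.inCStar_top X, by simp⟩
  | @insert a S _ _ ih =>
    obtain ⟨N, hN, hle⟩ := ih fun i hi => hP i (Set.mem_insert_of_mem _ hi)
    refine ⟨P a ⊓ N, inCStar.inf hC (hP a (Set.mem_insert _ _)) hN, ?_⟩
    rintro i (rfl | hi)
    · exact inf_le_left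
    · exact inf_le_right.trans (hle i hi)

theorem Residually.exists_inCStar (hC : IsRootClass C) {X : Type u} [Group X]
    (hX : Residually C X) {x : X} (hx : x ≠ 1) : ∃ N, inCStar C X N ∧ x ∉ N := by
  obtain ⟨G, _, f, -, hG, hfx⟩ := hX x hx
  exact ⟨f.ker, hC.inCStar_ker f hG, hfx⟩

theorem residually_of_inCStar {X : Type u} [Group X]
    (h : ∀ x : X, x ≠ 1 → ∃ N, inCStar C X N ∧ x ∉ N) : Residually C X := by
  intro x hx
  obtain ⟨N, ⟨hN, hCN⟩, hxN⟩ := h x hx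
  exact ⟨X ⧸ N, inferInstance, QuotientGroup.mk' N, QuotientGroup.mk'_surjective N, hCN,
    fun h1 => hxN ((QuotientGroup.eq_one_iff x).1 h1)⟩

theorem Residually.exists_avoiding (hC : IsRootClass C) {X : Type u} [Group X]
    (hX : Residually C X) (S : Set X) (hS : S.Finite) (h1 : (1 : X) ∉ S) :
    ∃ N, inCStar C X N ∧ ∀ x ∈ S, x ∉ N := by
  have : ∀ x : X, ∃ N, x ∈ S → inCStar C X N ∧ x ∉ N := fun x => by
    by_cases hx : x ∈ S
    · obtain ⟨N, hN⟩ := hX.exists_inCStar hC (x := x) (fun h => h1 (h ▸ hx))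
      exact ⟨N, fun _ => hN⟩
    · exact ⟨⊤, fun h => absurd h hx⟩
  choose P hP using this
  obtain ⟨N, hN, hle⟩ := hC.exists_le_of_finite S hS P fun i hi => (hP i hi).1
  exact ⟨N, hN, fun x hx hxN => (hP x hx).2 (hle x hx hxN)⟩

theorem Residually.exists_inf_eq_bot (hC : IsRootClass C) {X : Type u} [Group X]
    (hX : Residually C X) (A : Subgroup X) [Finite A] :
    ∃ N, inCStar C X N ∧ ∀ x ∈ A, x ∈ N → x = 1 := by
  obtain ⟨N, hN, h⟩ := hX.exists_avoiding hC ((A : Set X) \ {1})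
    (Set.Finite.subset (Set.toFinite (A : Set X)) Set.sdiff_subset) (by simp)
  refine ⟨N, hN, fun x hxA hxN => ?_⟩
  by_contra hx
  exact h x ⟨hxA, hx⟩ hxN

theorem Residually.of_injective (hC : IsRootClass C) {X Y : Type u} [Group X] [Group Y]
    (f : X →* Y) (hf : Function.Injective f) (hY : Residually C Y) : Residually C X := by
  refine residually_of_inCStar fun x hx => ?_
  obtain ⟨G, _, g, -, hG, hgx⟩ := hY (f x) (by rwa [Ne, map_eq_one_iff f hf])
  exact ⟨(g.comp f).ker, hC.inCStar_ker _ hG, hgx⟩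

/-- A group of automorphisms of `A` which are all induced by conjugation in a `C`-group
containing `A` is a `C`-group. -/
theorem IsRootClass.mulAut_of_conj (hC : IsRootClass C) (hquot : QuotClosed C)
    {A G : Type u} [Group A] [Group G] (e : A →* G) (he : Function.Injective e) (hG : C G)
    (V : Subgroup (MulAut A)) (hV : ∀ α ∈ V, ∃ g : G, ∀ a, e (α a) = g * e a * g⁻¹) : C V := by
  let P : Subgroup (G × V) :=
    { carrier := { p | ∀ a, e (p.2.1 a) = p.1 * e a * p.1⁻¹ }
      one_mem' := fun a => by simp
      mul_mem' := fun {p q} hp hq a => by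
        have h1 := hp (q.2.1 a)
        have h2 := hq a
        simp only [Prod.snd_mul, Subgroup.coe_mul, MulAut.mul_apply, Prod.fst_mul]
        rw [h1, h2]
        group
      inv_mem' := fun {p} hp a => by
        have h1 := hp (p.2.1⁻¹ a)
        rw [MulAut.apply_inv_self] at h1
        simp only [Prod.snd_inv, Subgroup.coe_inv, Prod.fst_inv]
        rw [h1]
        group }
  have hP : C P := by
    refine hC.of_injective ((MonoidHom.fst G V).comp P.subtype) ?_ hG
    rintro ⟨⟨g, α⟩, hα⟩ ⟨⟨g', β⟩, hβ⟩ h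
    have hg : g = g' := h
    subst hg
    have : α = β := Subtype.ext (MulEquiv.ext fun a => he ((hα a).trans (hβ a).symm))
    subst this
    rfl
  refine hC.of_surjective hquot ((MonoidHom.snd G V).comp P.subtype) ?_ hP
  rintro ⟨α, hα⟩
  obtain ⟨g, hg⟩ := hV α hα
  exact ⟨⟨(g, ⟨α, hα⟩), hg⟩, rfl⟩

end ClassClosure

section Cocycles

variable {B : Type u} [Group B] {H K : Subgroup B} {φ : H ≃* K}

open HNNExtension in
/-- A crossed homomorphism on an HNN-extension with values in functions `G → M` can be prescribed
on the base group and on the stable letter. -/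
theorem HNNExtension.exists_cocycle {G M : Type*} [Group G] [Group M]
    (f : HNNExtension B H K φ →* G) (c : B → G → M) (τ : G → M)
    (hc : ∀ b b' g, c (b * b') g = c b g * c b' ((f (of b))⁻¹ * g))
    (hτ : ∀ (h : H) g, τ g * c h ((f t)⁻¹ * g) =
      c (φ h : B) g * τ ((f (of (φ h : B)))⁻¹ * g)) :
    ∃ ℓ : HNNExtension B H K φ → G → M,
      (∀ x y g, ℓ (x * y) g = ℓ x g * ℓ y ((f x)⁻¹ * g)) ∧
      (∀ b, ℓ (of b) = c b) ∧ ℓ t = τ := by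
  let F₀ : B →* M ≀ᵣ G := MonoidHom.mk' (fun b => ⟨c b, f (of b)⟩) fun b b' => by
    ext g
    · simpa using hc b b' g
    · simp
  let F : HNNExtension B H K φ →* M ≀ᵣ G := lift F₀ ⟨τ, f t⟩ fun h => by
    ext g
    · simpa [F₀] using hτ h g
    · simp only [F₀, RegularWreathProduct.mul_right, MonoidHom.mk'_apply, ← map_mul, t_mul_of]
  have hFr : ∀ x, (F x).right = f x := by
    intro x
    have : (RegularWreathProduct.rightHom).comp F = f := by
      ext <;> simp [F, F₀]
    exact DFunLike.congr_fun this x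
  refine ⟨fun x => (F x).left, fun x y g => ?_, fun b => ?_, ?_⟩
  · simp [hFr]
  · simp [F, F₀]
  · simp [F]

/-- If `R` is normal and `D ≤ A R`, a homomorphism on `A` with kernel `A ∩ R` extends to a
homomorphism on `D` with kernel `D ∩ R`. -/
theorem exists_hom_extending {M : Type*} [Group M] (A R D : Subgroup B) [R.Normal]
    (hD : D ≤ A ⊔ R) (θ : A →* M) (hθ : ∀ a : A, θ a = 1 ↔ (a : B) ∈ R) :
    ∃ j : D →* M, (∀ (d : D) (a : A), (a : B)⁻¹ * d ∈ R → j d = θ a) ∧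
      ∀ d : D, j d = 1 → (d : B) ∈ R := by
  have hex : ∀ d : D, ∃ a : A, (a : B)⁻¹ * d ∈ R := fun d => by
    have hd : (d : B) ∈ ((A ⊔ R : Subgroup B) : Set B) := hD d.2
    rw [Subgroup.mul_normal] at hd
    obtain ⟨a, ha, r, hr, h⟩ := hd
    exact ⟨⟨a, ha⟩, by rw [← h]; simpa using hr⟩
  have huniq : ∀ (d : B) (a a' : A), (a : B)⁻¹ * d ∈ R → (a' : B)⁻¹ * d ∈ R → θ a = θ a' := by
    intro d a a' h h'
    have : ((a⁻¹ * a' : A) : B) ∈ R := by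
      have := R.mul_mem h (R.inv_mem h')
      simpa [mul_assoc] using this
    have h1 := (hθ _).2 this
    rw [map_mul, map_inv] at h1
    exact inv_mul_eq_one.1 h1
  choose p hp using hex
  refine ⟨MonoidHom.mk' (fun d => θ (p d)) fun d d' => ?_, fun d a h => huniq d _ _ (hp d) h,
    fun d hd => ?_⟩
  · rw [← map_mul]
    refine huniq (d * d' : B) _ _ (hp (d * d')) ?_
    have h1 := ‹R.Normal›.conj_mem _ (hp d) (p d' : B)⁻¹
    have h2 := R.mul_mem h1 (hp d')
    convert h2 using 1
    push_cast
    group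
  · simpa using R.mul_mem ((hθ _).1 hd) (hp d)

open HNNExtension in
/-- Extending homomorphisms from `ker f ∩ B` to `ker f`, up to conjugation in `B`. -/
theorem HNNExtension.exists_hom_ker {G M : Type*} [Group G] [Group M]
    (f : HNNExtension B H K φ →* G) (j : G → ((f.comp of).ker →* M))
    (hj : ∀ b g, j (f (of b) * g) = j g)
    (hm : ∀ g (b b' : B), ∃ m : M, ∀ (h : H) (x y : (f.comp of).ker), f (of (h : B)) = 1 →
      (x : B) = b * h * b⁻¹ → (y : B) = b' * φ h * b'⁻¹ →
      j g y * m = m * j ((f t)⁻¹ * g) x)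
    (g₀ : G) :
    ∃ (ρ : f.ker →* M) (s : B), ∀ (b : B) (hb : of b ∈ f.ker) (y : (f.comp of).ker),
      (y : B) = s⁻¹ * b * s → ρ ⟨of b, hb⟩ = j g₀ y := by
  obtain ⟨r, hr, σ, hσ⟩ : ∃ r : G → G, (∀ b g, r (f (of b) * g) = r g) ∧
      ∃ σ : G → B, ∀ g, g = f (of (σ g)) * r g := by
    let S := QuotientGroup.rightRel (f.comp of).range
    refine ⟨fun g => (Quotient.mk S g).out, fun b g => ?_, ?_⟩
    · refine congrArg Quotient.out (Quotient.sound ?_)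
      refine QuotientGroup.rightRel_apply.2 ⟨b⁻¹, ?_⟩
      simp
    · have : ∀ g, ∃ b, g = f (of b) * (Quotient.mk S g).out := fun g => by
        obtain ⟨b, hb⟩ := QuotientGroup.rightRel_apply.1 (Quotient.mk_out (s := S) g)
        exact ⟨b, by rw [← MonoidHom.comp_apply, hb]; group⟩
      choose σ hσ using this
      exact ⟨σ, hσ⟩
  have hmem : ∀ b g, (σ g)⁻¹ * b * σ ((f (of b))⁻¹ * g) ∈ (f.comp of).ker := by
    intro b g
    have h1 : f (of (σ g)) = g * (r g)⁻¹ := eq_mul_inv_of_mul_eq (hσ g).symm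
    have h2 : f (of (σ ((f (of b))⁻¹ * g))) = (f (of b))⁻¹ * g * (r g)⁻¹ := by
      refine eq_mul_inv_of_mul_eq ?_
      have := hr b⁻¹ g
      rw [map_inv, map_inv] at this
      rw [← this]
      exact (hσ _).symm
    rw [MonoidHom.mem_ker, MonoidHom.comp_apply, map_mul, map_mul, map_mul, map_mul, map_inv,
      map_inv, h1, h2]
    group
  let c : B → G → M := fun b g => j g ⟨_, hmem b g⟩
  have hc : ∀ b b' g, c (b * b') g = c b g * c b' ((f (of b))⁻¹ * g) := by
    intro b b' g
    have h1 : j ((f (of b))⁻¹ * g) = j g := by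
      have := hj b⁻¹ g
      rwa [map_inv, map_inv] at this
    simp only [c]
    rw [h1, ← map_mul]
    congr 1
    refine Subtype.ext ?_
    simp only [Subgroup.coe_mul, map_mul, mul_inv_rev, mul_assoc]
    group
  have hc1 : ∀ (b : B) g, f (of b) = 1 → ∀ y : (f.comp of).ker,
      (y : B) = (σ g)⁻¹ * b * σ g → c b g = j g y := by
    intro b g hb y hy
    simp only [c]
    congr 1
    refine Subtype.ext ?_
    simp only [hb, hy, inv_one, one_mul]
  have hconj : ∀ h : H, f (of (φ h : B)) = f t * f (of (h : B)) * (f t)⁻¹ := by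
    intro h
    rw [equiv_eq_conj]; simp
  have hm' : ∀ g, ∃ m : M, ∀ h : H, f (of (h : B)) = 1 →
      c (φ h : B) g * m = m * c h ((f t)⁻¹ * g) := by
    intro g
    obtain ⟨m, hmg⟩ := hm g (σ ((f t)⁻¹ * g))⁻¹ (σ g)⁻¹
    refine ⟨m, fun h hh => ?_⟩
    have hφ : f (of (φ h : B)) = 1 := by rw [hconj, hh]; simp
    have hker : ∀ b s : B, f (of b) = 1 → s⁻¹ * b * s ∈ (f.comp of).ker := fun b s hb => by
      simp [MonoidHom.mem_ker, hb]
    rw [hc1 _ g hφ ⟨_, hker _ (σ g) hφ⟩ rfl,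
      hc1 _ ((f t)⁻¹ * g) hh ⟨_, hker _ (σ ((f t)⁻¹ * g)) hh⟩ rfl]
    exact hmg h _ _ hh (by simp) (by simp)
  choose m hm' using hm'
  obtain ⟨q, hq, κ, hκ⟩ : ∃ q : G → G, (∀ (h : H) g, q ((f (of (φ h : B)))⁻¹ * g) = q g) ∧
      ∃ κ : G → H, ∀ g, q g = f (of (φ (κ g) : B)) * g := by
    let P := ((f.comp of).comp (K.subtype.comp φ.toMonoidHom)).range
    let S := QuotientGroup.rightRel P
    refine ⟨fun g => (Quotient.mk S g).out, fun h g => ?_, ?_⟩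
    · refine congrArg Quotient.out (Quotient.sound ?_)
      refine QuotientGroup.rightRel_apply.2 ⟨h, ?_⟩
      simp
    · have : ∀ g, ∃ h : H, (Quotient.mk S g).out = f (of (φ h : B)) * g := fun g => by
        obtain ⟨h, hh⟩ := QuotientGroup.rightRel_apply.1 (Quotient.mk_out (s := S) g)
        refine ⟨h⁻¹, ?_⟩
        have hh' : f (of (φ h : B)) = g * (Quotient.mk S g).out⁻¹ := hh
        rw [map_inv, Subgroup.coe_inv, map_inv, map_inv, hh']
        group
      choose κ hκ using this
      exact ⟨κ, hκ⟩
  let T : H → G → M := fun k s => (c (φ k : B) s)⁻¹ * m s * c k ((f t)⁻¹ * s)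
  have hT : ∀ (k k' : H) s, f (of (φ k : B)) = f (of (φ k' : B)) → T k s = T k' s := by
    intro k k' s h
    obtain ⟨d, rfl⟩ : ∃ d, k' = d * k := ⟨k' * k⁻¹, by simp⟩
    have hd : f (of (φ d : B)) = 1 := by
      rw [map_mul, Subgroup.coe_mul, map_mul, map_mul] at h
      exact right_eq_mul.1 h
    have hd' : f (of (d : B)) = 1 := by
      rw [hconj] at hd
      simpa using hd
    simp only [T]
    rw [map_mul, Subgroup.coe_mul, Subgroup.coe_mul, hc, hc, hd, hd', inv_one, one_mul, one_mul,
      mul_inv_rev]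
    have e : (c (φ d : B) s)⁻¹ * m s * c d ((f t)⁻¹ * s) = m s := by
      rw [mul_assoc, ← hm' s d hd', inv_mul_cancel_left]
    conv_lhs => rw [← e]
    group
  obtain ⟨ℓ, hℓ, hℓc, -⟩ := exists_cocycle f c (fun g => T (κ g) (q g)) hc fun h g => by
    have h1 : T (κ ((f (of (φ h : B)))⁻¹ * g)) (q g) = T (κ g * h) (q g) := by
      refine hT _ _ _ ?_
      have h2 := hκ ((f (of (φ h : B)))⁻¹ * g)
      rw [hq, hκ g] at h2
      rw [map_mul, Subgroup.coe_mul, map_mul, map_mul]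
      have := congrArg (· * (g⁻¹ * f (of (φ h : B)))) h2
      simpa [mul_assoc] using this.symm
    have h3 : (f (of (φ (κ g) : B)))⁻¹ * q g = g := by rw [hκ g, inv_mul_cancel_left]
    have h4 : (f (of (κ g : B)))⁻¹ * ((f t)⁻¹ * q g) = (f t)⁻¹ * g := by
      rw [hκ g, hconj]; group
    rw [hq, h1]
    simp only [T]
    rw [map_mul, Subgroup.coe_mul, Subgroup.coe_mul, hc, hc, h3, h4]
    group
  refine ⟨MonoidHom.mk' (fun x => ℓ x g₀) fun x y => ?_, σ g₀, fun b hb y hy => ?_⟩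
  · have hx : f x = 1 := x.2
    simp [hℓ, hx]
  · rw [← hc1 b g₀ hb y hy, ← hℓc]
    rfl

end Cocycles

section ReducedWords

variable {B : Type u} [Group B] {H K : Subgroup B} {φ : H ≃* K}

open HNNExtension HNNExtension.NormalWord

/-- The element `t ^ u₁ * b₁ * t ^ u₂ * b₂ * ⋯` of the HNN-extension. -/
def HNNExtension.wordProd (φ : H ≃* K) (l : List (ℤˣ × B)) : HNNExtension B H K φ :=
  (l.map fun x => t ^ (x.1 : ℤ) * of x.2).prod

@[simp]
theorem HNNExtension.wordProd_nil : wordProd φ [] = 1 := rfl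

theorem HNNExtension.wordProd_cons (a : ℤˣ × B) (l : List (ℤˣ × B)) :
    wordProd φ (a :: l) = t ^ (a.1 : ℤ) * of a.2 * wordProd φ l := by
  simp [wordProd]

theorem HNNExtension.wordProd_concat (l : List (ℤˣ × B)) (a : ℤˣ × B) :
    wordProd φ (l ++ [a]) = wordProd φ l * (t ^ (a.1 : ℤ) * of a.2) := by
  simp [wordProd]

/-- The cocycle counting the occurrences of an edge of the graph with vertices `f(B) \ G` and
edges `f(K) \ G` in a path. -/
theorem HNNExtension.exists_edge_cocycle {G Z : Type*} [Group G] [Group Z]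
    (f : HNNExtension B H K φ →* G) (w : G) (z : Z) :
    ∃ ℓ : HNNExtension B H K φ → G → Z,
      (∀ x y g, ℓ (x * y) g = ℓ x g * ℓ y ((f x)⁻¹ * g)) ∧
      (∀ b g, ℓ (of b) g = 1) ∧ ℓ t w = z ∧
      ∀ g, (∀ k : K, g * w⁻¹ ≠ f (of (k : B))) → ℓ t g = 1 := by
  classical
  let P : Subgroup G := ((f.comp of).comp K.subtype).range
  obtain ⟨ℓ, h1, h2, h3⟩ := exists_cocycle f (fun _ _ => (1 : Z))
    (fun g => if g * w⁻¹ ∈ P then z else 1) (by simp) (fun h g => by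
      have : (f (of (φ h : B)))⁻¹ * g * w⁻¹ ∈ P ↔ g * w⁻¹ ∈ P := by
        rw [mul_assoc]
        exact P.mul_mem_cancel_left (P.inv_mem ⟨φ h, rfl⟩)
      simp [this])
  refine ⟨ℓ, h1, fun b g => by rw [h2], by rw [h3]; simp [P.one_mem], fun g hg => ?_⟩
  rw [h3]
  refine if_neg ?_
  rintro ⟨k, hk⟩
  exact hg k hk.symm

theorem HNNExtension.exists_inCStar_prefix {C : GroupClass.{u}} (hC : IsRootClass C)
    (hsep : ∀ (v : ℤˣ) (b : B), b ∉ toSubgroup H K v →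
      ∃ N : Subgroup (HNNExtension B H K φ), inCStar C _ N ∧
        ∀ a ∈ toSubgroup H K v, of (b * a) ∉ N) (n : ℕ) :
    ∀ l : List (ℤˣ × B), l.length = n →
      l.IsChain (fun a b => a.2 ∈ toSubgroup H K a.1 → a.1 = b.1) →
      ∃ N : Subgroup (HNNExtension B H K φ), inCStar C _ N ∧
        ∀ P, P ≠ [] → P <+: l → ∀ b, wordProd φ P * of b ∉ N := by
  induction n with
  | zero =>
    intro l hl _
    obtain rfl := List.length_eq_zero_iff.1 hl
    exact ⟨⊤, hC.inCStar_top _, fun P hP hPl => absurd (List.prefix_nil.1 hPl) hP⟩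
  | succ n ih =>
    rintro (_ | ⟨⟨v, g⟩, l⟩) hl hchain
    · simp at hl
    have hl' : l.length = n := by simpa using hl
    obtain ⟨N₁, hN₁, h₁⟩ := ih l hl' hchain.tail
    obtain ⟨N₂, hN₂, h₂⟩ := ih ((v, g) :: l).dropLast (by simp [hl'])
      (hchain.prefix (List.dropLast_prefix _))
    obtain ⟨N₃, hN₃, h₃⟩ : ∃ N : Subgroup (HNNExtension B H K φ), inCStar C _ N ∧
        (g ∉ toSubgroup H K v → ∀ a ∈ toSubgroup H K v, of (g * a) ∉ N) := by
      by_cases hg : g ∈ toSubgroup H K v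
      · exact ⟨⊤, hC.inCStar_top _, fun h => absurd hg h⟩
      · obtain ⟨N, hN, h⟩ := hsep v g hg
        exact ⟨N, hN, fun _ => h⟩
    obtain ⟨hN, hCN⟩ := inCStar.inf hC (inCStar.inf hC hN₁ hN₂) hN₃
    generalize hNdef : N₁ ⊓ N₂ ⊓ N₃ = N at hN hCN
    have hle₁ : N ≤ N₁ := hNdef ▸ inf_le_left.trans inf_le_left
    have hle₂ : N ≤ N₂ := hNdef ▸ inf_le_left.trans inf_le_right
    have hle₃ : N ≤ N₃ := hNdef ▸ inf_le_right
    let f := QuotientGroup.mk' N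
    have hf : ∀ x, f x = 1 ↔ x ∈ N := fun x => QuotientGroup.eq_one_iff x
    obtain ⟨Z, _, z, hZ, hz⟩ := hC.exists_mem_ne_one
    obtain ⟨ℓ, hℓ, hℓB, hℓw, hℓt⟩ := exists_edge_cocycle f (if v = 1 then 1 else f t) z
    have hℓ1 : ∀ x, ℓ 1 x = 1 := fun x => by simpa using hℓB 1 x
    have hℓinv : ∀ x, ℓ t⁻¹ x = (ℓ t (f t * x))⁻¹ := fun x => by
      have := hℓ t⁻¹ t x
      rw [inv_mul_cancel, hℓ1, map_inv, inv_inv] at this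
      exact eq_inv_of_mul_eq_one_left this.symm
    have hfirst : ℓ (t ^ (v : ℤ)) 1 ≠ 1 := by
      rcases Int.units_eq_one_or v with rfl | rfl
      · simpa using (show ℓ t 1 ≠ 1 by simpa using hℓw ▸ hz)
      · have : ℓ t (f t) = z := by simpa using hℓw
        simpa [hℓinv, this] using hz
    have hconj : ∀ k : K, f (of (φ.symm k : B)) = (f t)⁻¹ * f (of (k : B)) * f t := fun k => by
      rw [equiv_symm_eq_conj]; simp
    have hletter : ∀ (l₁ : List (ℤˣ × B)) (v' : ℤˣ) (b : B), l₁ ++ [(v', b)] <+: l →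
        ℓ (t ^ (v' : ℤ)) (f (t ^ (v : ℤ) * of g * wordProd φ l₁))⁻¹ = 1 := by
      intro l₁ v' b hpre
      have hl₁ : l₁ <+: l := (List.prefix_append _ _).trans hpre
      have F₁ : ∀ a : B, (f (t ^ (v : ℤ) * of g * wordProd φ l₁))⁻¹ ≠ f (of a) := by
        intro a ha
        refine h₂ ((v, g) :: l₁) (by simp) ?_ a (hle₂ ?_)
        · refine List.prefix_of_prefix_length_le (List.cons_prefix_cons.2 ⟨rfl, hl₁⟩)
            (List.dropLast_prefix _) ?_
          have := hpre.length_le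
          simp at this ⊢
          omega
        · rw [← hf, map_mul, ← ha, wordProd_cons, mul_inv_cancel]
      have F₂ : v ≠ v' → ∀ a ∈ toSubgroup H K v,
          (f (wordProd φ l₁))⁻¹ * (f (of g))⁻¹ ≠ f (of a) := by
        intro hv a ha h
        rcases eq_or_ne l₁ [] with rfl | hne
        · obtain ⟨l₂, rfl⟩ := hpre
          have hg : g ∉ toSubgroup H K v := fun hg =>
            hv ((List.isChain_cons_cons.1 hchain).1 hg)
          refine h₃ hg a ha (hle₃ ((hf _).1 ?_))
          rw [map_mul, map_mul, ← h]
          simp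
        · refine h₁ l₁ hne hl₁ (a * g) (hle₁ ((hf _).1 ?_))
          rw [map_mul, map_mul, map_mul, ← h]
          group
      rcases Int.units_eq_one_or v with rfl | rfl <;>
        rcases Int.units_eq_one_or v' with rfl | rfl
      · simp only [Units.val_one, zpow_one] at F₁ ⊢
        refine hℓt _ fun k hk => F₁ k ?_
        simpa using hk
      · simp only [Units.val_one, zpow_one, Units.val_neg, zpow_neg] at F₁ F₂ ⊢
        rw [hℓinv, inv_eq_one]
        refine hℓt _ fun k hk => F₂ (by decide) (φ.symm k) (φ.symm k).2 ?_
        rw [hconj, ← hk]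
        simp [mul_assoc]
      · simp only [Units.val_one, zpow_one, Units.val_neg, zpow_neg] at F₁ F₂ ⊢
        refine hℓt _ fun k hk => F₂ (by decide) k k.2 ?_
        rw [← hk, if_neg (by decide)]
        simp [mul_assoc]
      · simp only [Units.val_one, zpow_one, Units.val_neg, zpow_neg] at F₁ ⊢
        rw [hℓinv, inv_eq_one]
        refine hℓt _ fun k hk => F₁ (φ.symm k) ?_
        rw [hconj, ← hk, if_neg (by decide)]
        simp [mul_assoc]
    have htail : ∀ P : List (ℤˣ × B), P <+: l →
        ℓ (wordProd φ P) (f (t ^ (v : ℤ) * of g))⁻¹ = 1 := by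
      intro P
      induction P using List.reverseRecOn with
      | nil => intro _; simp [hℓ1]
      | append_singleton P a ihP =>
        intro hP
        rw [wordProd_concat, hℓ, hℓ, hℓB, ihP ((List.prefix_append _ _).trans hP)]
        have := hletter P a.1 a.2 hP
        rw [map_mul, mul_inv_rev] at this
        rw [this]
        simp
    obtain ⟨T, hT, hTN, hTρ⟩ := hC.exists_le_ker f
      (MonoidHom.mk' (fun x : f.ker => ℓ x 1) fun x y => by
        have hx : f x = 1 := x.2
        simp [hℓ, hx]) hCN hZ
    refine ⟨T, hT, fun P hP hPl b hb => ?_⟩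
    obtain ⟨a, P, rfl⟩ := List.exists_cons_of_ne_nil hP
    obtain ⟨rfl, hPl'⟩ := List.cons_prefix_cons.1 hPl
    have h := hTρ _ (hTN hb) hb
    simp only [MonoidHom.mk'_apply] at h
    rw [hℓ, hℓB, wordProd_cons, hℓ, hℓ, hℓB, mul_one, mul_one, mul_one, htail P hPl', mul_one] at h
    exact hfirst h

/-- If the base group can be separated from the identity and, modulo the associated subgroups,
from the associated subgroups, then the HNN-extension is residually a `C`-group. -/
theorem HNNExtension.residually_of_separated {C : GroupClass.{u}} (hC : IsRootClass C)
    (hB : ∀ b : B, b ≠ 1 → ∃ N : Subgroup (HNNExtension B H K φ), inCStar C _ N ∧ of b ∉ N)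
    (hsep : ∀ (v : ℤˣ) (b : B), b ∉ toSubgroup H K v →
      ∃ N : Subgroup (HNNExtension B H K φ), inCStar C _ N ∧
        ∀ a ∈ toSubgroup H K v, of (b * a) ∉ N) :
    Residually C (HNNExtension B H K φ) := by
  refine residually_of_inCStar fun x hx => ?_
  obtain ⟨d⟩ := TransversalPair.nonempty B H K
  obtain ⟨w, rfl⟩ : ∃ w : NormalWord d, w.prod φ = x :=
    ⟨x • NormalWord.empty, by rw [prod_smul, prod_empty, mul_one]⟩
  have hw : w.prod φ = of w.head * wordProd φ w.toList := rfl
  rw [hw] at hx ⊢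
  rcases eq_or_ne w.toList [] with hnil | hne
  · rw [hnil, wordProd_nil, mul_one] at hx ⊢
    exact hB _ fun h => hx (by rw [h, map_one])
  · obtain ⟨N, hN, h⟩ := exists_inCStar_prefix hC hsep _ w.toList rfl w.chain
    refine ⟨N, hN, fun hmem => h _ hne List.prefix_rfl w.head ?_⟩
    obtain ⟨hn, -⟩ := hN
    exact hn.mem_comm hmem

end ReducedWords

section AssociatedSubgroups

variable {C : GroupClass.{u}}

/-- An extension of `C`-groups in which the automorphisms from `U` are induced by conjugation. -/
theorem IsRootClass.exists_hom_realizing (hC : IsRootClass C) (hquot : QuotClosed C)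
    {A : Type u} [Group A] (hA : C A) (U : Subgroup (MulAut A)) (hU : C U) (N : Subgroup A)
    [N.Normal] (hN : ∀ α ∈ U, ∀ a ∈ N, α a ∈ N) :
    ∃ (M : Type u) (_ : Group M) (θ : A →* M), C M ∧ (∀ a, θ a = 1 ↔ a ∈ N) ∧
      ∀ α ∈ U, ∃ m, ∀ a, θ (α a) * m = m * θ a := by
  let T : Subgroup (A ⋊[U.subtype] U) := N.map SemidirectProduct.inl
  have hT : T.Normal := by
    refine ⟨?_⟩
    rintro _ ⟨a, ha, rfl⟩ g
    refine ⟨g.left * g.right.1 a * g.left⁻¹,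
      ‹N.Normal›.conj_mem _ (hN _ g.right.2 _ ha) _, ?_⟩
    ext <;> simp
  refine ⟨(A ⋊[U.subtype] U) ⧸ T, inferInstance,
    (QuotientGroup.mk' T).comp SemidirectProduct.inl,
    hquot _ T (hC.semidirectProduct _ hA hU), fun a => ?_, fun α hα =>
      ⟨QuotientGroup.mk' T (SemidirectProduct.inr ⟨α, hα⟩), fun a => ?_⟩⟩
  · rw [MonoidHom.comp_apply, QuotientGroup.mk'_apply, QuotientGroup.eq_one_iff]
    exact Subgroup.mem_map_iff_mem SemidirectProduct.inl_injective
  · rw [MonoidHom.comp_apply, MonoidHom.comp_apply, ← map_mul, ← map_mul]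
    congr 1
    ext <;> simp

theorem IsRootClass.quotient_of_le (hC : IsRootClass C) (hquot : QuotClosed C) {X : Type u}
    [Group X] {Q S : Subgroup X} [Q.Normal] [S.Normal] (h : Q ≤ S) (hQ : C (X ⧸ Q)) :
    C (X ⧸ S) := by
  refine hC.of_surjective hquot (QuotientGroup.map Q S (MonoidHom.id X) h) ?_ hQ
  exact QuotientGroup.map_surjective_of_surjective Q S (MonoidHom.id X)
    (QuotientGroup.mk'_surjective S) h

theorem mem_of_mem_sup {B : Type u} [Group B] {P A Q : Subgroup B} [Q.Normal]
    (hQ : ∀ x ∈ P, x ∈ Q → x = 1) (hA : A ≤ P) {x : B} (hxP : x ∈ P) (hx : x ∈ A ⊔ Q) :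
    x ∈ A := by
  have hx' : x ∈ ((A ⊔ Q : Subgroup B) : Set B) := hx
  rw [Subgroup.mul_normal] at hx'
  obtain ⟨a, ha, q, hq, rfl⟩ := hx'
  have : q = 1 := hQ q ((P.mul_mem_cancel_left (hA ha)).1 hxP) hq
  simpa [this] using ha

variable {B : Type u} [Group B] {H K : Subgroup B} {φ : H ≃* K}

open HNNExtension

/-- A `C`-quotient of the HNN-extension can be refined by a compatible family of homomorphisms
from the kernel of its restriction to the base group. -/
theorem HNNExtension.exists_inCStar_of_compatible (hC : IsRootClass C) {G M : Type u} [Group G]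
    [Group M] (hG : C G) (hM : C M)
    (f : HNNExtension B H K φ →* G) (j : G → ((f.comp of).ker →* M))
    (hj : ∀ b g, j (f (of b) * g) = j g)
    (hm : ∀ g (b b' : B), ∃ m : M, ∀ (h : H) (x y : (f.comp of).ker), f (of (h : B)) = 1 →
      (x : B) = b * h * b⁻¹ → (y : B) = b' * φ h * b'⁻¹ →
      j g y * m = m * j ((f t)⁻¹ * g) x)
    (g₀ : G) (R : Subgroup B) [R.Normal] (hR : ∀ y, j g₀ y = 1 → (y : B) ∈ R) :
    ∃ N : Subgroup (HNNExtension B H K φ), inCStar C _ N ∧ ∀ b, of b ∈ N → b ∈ R := by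
  obtain ⟨ρ, s, hρ⟩ := exists_hom_ker f j hj hm g₀
  obtain ⟨N, hN, hNf, h⟩ := hC.exists_le_ker f ρ hG hM
  refine ⟨N, hN, fun b hb => ?_⟩
  have hbf : f (of b) = 1 := hNf hb
  have hy : s⁻¹ * b * s ∈ (f.comp of).ker := by simp [MonoidHom.mem_ker, hbf]
  have h1 := hR ⟨_, hy⟩ ((hρ b (hNf hb) _ rfl).symm.trans (h _ (hNf hb) hb))
  simpa [mul_assoc] using ‹R.Normal›.conj_mem _ h1 s

theorem IsRestrictionToL.mem_iff {ψ : MulAut ↥(H ⊓ K)} (hψ : IsRestrictionToL H K φ ψ) (h : H) :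
    (h : B) ∈ K ↔ (φ h : B) ∈ H := by
  refine ⟨fun hK => ?_, fun hH => ?_⟩
  · have := (ψ ⟨h, h.2, hK⟩).2.1
    rwa [hψ] at this
  · obtain ⟨y, hy⟩ := ψ.surjective ⟨φ h, hH, (φ h).2⟩
    have h1 := hψ y
    rw [hy] at h1
    have h2 : h = ⟨y, y.2.1⟩ := φ.injective (Subtype.ext h1)
    rw [h2]
    exact y.2.2

theorem conjNormal_mem_autOf (hH : H.Normal) (b : B) : MulAut.conjNormal b ∈ autOf B H :=
  ⟨b, fun _ => MulAut.conjNormal_apply _ _⟩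

theorem mem_of_mem_frakU (hK : K.Normal) (hH : H.Normal) {ψ : MulAut ↥(H ⊓ K)}
    (hψ : IsRestrictionToL H K φ ψ) {α : MulAut H} (hα : α ∈ frakU H K φ) (h : H) :
    ((α h : H) : B) ∈ K ↔ (h : B) ∈ K := by
  let P : Subgroup (MulAut H) :=
    { carrier := { α | ∀ h, ((α h : H) : B) ∈ K ↔ (h : B) ∈ K }
      one_mem' := fun h => Iff.rfl
      mul_mem' := fun {α β} hα hβ h => (hα (β h)).trans (hβ h)
      inv_mem' := fun {α} hα h => by
        have := hα (α⁻¹ h)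
        rw [MulAut.apply_inv_self] at this
        exact this.symm }
  have hle : frakU H K φ ≤ P := by
    refine sup_le ?_ ?_
    · rintro α ⟨b, hb⟩ h
      rw [hb, hK.mem_comm_iff, inv_mul_cancel_left]
    · rintro _ ⟨β, ⟨b, hb⟩, rfl⟩ h
      rw [hψ.mem_iff, hψ.mem_iff]
      have : φ (autConjHom φ β h) = β (φ h) := φ.apply_symm_apply _
      rw [this, hb, hH.mem_comm_iff, inv_mul_cancel_left]
  exact hle hα h

/-- If `𝔘` is a `C`-group, some `C`-quotient of the HNN-extension has a kernel meeting the base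
group inside `(H ∩ K) Q`. -/
theorem exists_inCStar_le_inf_sup (hC : IsRootClass C) (hquot : QuotClosed C) (hH : H.Normal)
    (hK : K.Normal) {ψ : MulAut ↥(H ⊓ K)} (hψ : IsRestrictionToL H K φ ψ)
    (hU : C (frakU H K φ)) {Q : Subgroup B} (hQ : inCStar C B Q)
    (hQ1 : ∀ x ∈ H ⊔ K, x ∈ Q → x = 1) :
    ∃ N : Subgroup (HNNExtension B H K φ), inCStar C _ N ∧ ∀ b, of b ∈ N → b ∈ H ⊓ K ⊔ Q := by
  classical
  obtain ⟨hQn, hCQ⟩ := hQ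
  have hHC : C H := by
    refine hC.of_injective ((QuotientGroup.mk' Q).comp H.subtype) ?_ hCQ
    refine (injective_iff_map_eq_one _).2 fun x hx => Subtype.ext ?_
    exact hQ1 x (le_sup_left (a := H) x.2) ((QuotientGroup.eq_one_iff _).1 hx)
  obtain ⟨M, _, θ, hM, hθ, hθU⟩ := hC.exists_hom_realizing hquot hHC (frakU H K φ) hU
    (K.subgroupOf H) fun α hα a ha => (mem_of_mem_frakU hK hH hψ hα a).2 ha
  obtain ⟨Z, _, z, hZ, hz⟩ := hC.exists_mem_ne_one
  let S := H ⊔ K ⊔ Q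
  have hS : C (B ⧸ S) := hC.quotient_of_le hquot (le_sup_right : Q ≤ S) hCQ
  have hSH : ∀ h : H, QuotientGroup.mk' S h = 1 := fun h =>
    (QuotientGroup.eq_one_iff _).2 ((le_sup_left.trans le_sup_left : H ≤ S) h.2)
  have hSK : ∀ k : K, QuotientGroup.mk' S k = 1 := fun k =>
    (QuotientGroup.eq_one_iff _).2 ((le_sup_right.trans le_sup_left : K ≤ S) k.2)
  let f : HNNExtension B H K φ →* (B ⧸ S) × Z :=
    lift ((MonoidHom.inl _ Z).comp (QuotientGroup.mk' S)) (1, z) fun h => by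
      simp only [MonoidHom.comp_apply, hSH, hSK, map_one, one_mul, mul_one]
  have hft : f t = (1, z) := lift_t _ _ _
  have hfB : ∀ b, f (of b) = (QuotientGroup.mk' S b, 1) := fun b => lift_of _ _ _ _
  have hD : (f.comp of).ker = S := by
    ext b
    rw [MonoidHom.mem_ker, MonoidHom.comp_apply, hfB, Prod.mk_eq_one]
    simp [QuotientGroup.eq_one_iff]
  obtain ⟨jH, hjH, hjH1⟩ := exists_hom_extending H (K ⊔ Q) (f.comp of).ker
    (by rw [hD, ← sup_assoc]) θ fun a => (hθ a).trans
      ⟨fun h => le_sup_left (a := K) h,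
        fun h => mem_of_mem_sup hQ1 le_sup_right (le_sup_left (a := H) a.2) h⟩
  obtain ⟨jK, hjK, hjK1⟩ := exists_hom_extending K (H ⊔ Q) (f.comp of).ker
    (by rw [hD, ← sup_assoc, sup_comm K H]) (θ.comp φ.symm.toMonoidHom) fun a => by
      have h1 : θ (φ.symm a) = 1 ↔ (a : B) ∈ H := by
        rw [hθ, Subgroup.mem_subgroupOf, hψ.mem_iff, φ.apply_symm_apply]
      exact h1.trans ⟨fun h => le_sup_left (a := H) h,
        fun h => mem_of_mem_sup hQ1 le_sup_left (le_sup_right (a := H) a.2) h⟩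
  have hjHK : ∀ y : (f.comp of).ker, (y : B) ∈ K → jH y = 1 := fun y hy => by
    rw [hjH y 1 (by simpa using le_sup_left (a := K) hy), map_one]
  have hjKH : ∀ y : (f.comp of).ker, (y : B) ∈ H → jK y = 1 := fun y hy => by
    rw [hjK y 1 (by simpa using le_sup_left (a := H) hy), map_one]
  let j : (B ⧸ S) × Z → ((f.comp of).ker →* M) := fun g =>
    if g.2 = 1 then jH else if g.2 = z then jK else 1
  have hj : ∀ b g, j (f (of b) * g) = j g := fun b g => by
    simp only [j, hfB, Prod.snd_mul, one_mul]
  have hm : ∀ g (b b' : B), ∃ m : M, ∀ (h : H) (x y : (f.comp of).ker), f (of (h : B)) = 1 →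
      (x : B) = b * h * b⁻¹ → (y : B) = b' * φ h * b'⁻¹ →
      j g y * m = m * j ((f t)⁻¹ * g) x := by
    intro g b b'
    by_cases hg : g.2 = z
    · let α : MulAut H := autConjHom φ (MulAut.conjNormal b') * (MulAut.conjNormal b)⁻¹
      have hα : α ∈ frakU H K φ := mul_mem
        (le_sup_right (a := autOf B H) ⟨_, conjNormal_mem_autOf hK b', rfl⟩)
        (le_sup_left (a := autOf B H) (inv_mem (conjNormal_mem_autOf hH b)))
      obtain ⟨m, hmα⟩ := hθU α hα
      refine ⟨m, fun h x y _ hx hy => ?_⟩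
      have hy' : jK y = θ (φ.symm (MulAut.conjNormal b' (φ h))) :=
        hjK y (MulAut.conjNormal b' (φ h)) (by simp [hy, mul_assoc])
      have hx' : jH x = θ (MulAut.conjNormal b h) :=
        hjH x (MulAut.conjNormal b h) (by simp [hx, mul_assoc])
      have hα' : α (MulAut.conjNormal b h) = φ.symm (MulAut.conjNormal b' (φ h)) := by
        simp only [α, MulAut.mul_apply, MulAut.inv_apply_self]
        rfl
      simp only [j, hft, hg, hz, if_false, if_true, Prod.snd_mul, Prod.snd_inv, inv_mul_cancel]
      rw [hy', hx', ← hα', hmα]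
    · refine ⟨1, fun h x y _ hx hy => ?_⟩
      have hxH : (x : B) ∈ H := hx ▸ hH.conj_mem _ h.2 b
      have hyK : (y : B) ∈ K := hy ▸ hK.conj_mem _ (φ h).2 b'
      have hg' : z⁻¹ * g.2 ≠ 1 := fun e => hg (inv_mul_eq_one.1 e).symm
      have e1 : j g y = 1 := by
        simp only [j, hg, if_false]
        split_ifs
        · exact hjHK y hyK
        · rfl
      have e2 : j ((f t)⁻¹ * g) x = 1 := by
        simp only [j, hft, Prod.snd_mul, Prod.snd_inv, hg', if_false]
        split_ifs
        · exact hjKH x hxH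
        · rfl
      rw [e1, e2]
  obtain ⟨N₁, hN₁, h₁⟩ := exists_inCStar_of_compatible hC (hC.prod hS hZ) hM f j hj hm (1, 1)
    (K ⊔ Q) fun y hy => hjH1 y (by simpa [j] using hy)
  obtain ⟨N₂, hN₂, h₂⟩ := exists_inCStar_of_compatible hC (hC.prod hS hZ) hM f j hj hm (1, z)
    (H ⊔ Q) fun y hy => hjK1 y (by simpa [j, hz] using hy)
  refine ⟨N₁ ⊓ N₂, inCStar.inf hC hN₁ hN₂, fun b hb => ?_⟩
  have hbH : b ∈ ((H ⊔ Q : Subgroup B) : Set B) := h₂ b hb.2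
  rw [Subgroup.mul_normal] at hbH
  obtain ⟨a, ha, q, hq, rfl⟩ := hbH
  have haK : a ∈ K ⊔ Q :=
    (mul_mem_cancel_right (le_sup_right (a := K) hq)).1 (h₁ _ hb.1)
  exact mul_mem (le_sup_left (a := H ⊓ K)
    ⟨ha, mem_of_mem_sup hQ1 le_sup_right (le_sup_left (a := H) ha) haK⟩)
    (le_sup_right (a := H ⊓ K) hq)

/-- If `𝔙` is a `C`-group, a `C`-quotient of the HNN-extension whose kernel meets the base group
inside `(H ∩ K) Q` can be refined to one whose kernel meets the base group inside `Q`. -/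
theorem exists_inCStar_le_of_inf_sup (hC : IsRootClass C) (hquot : QuotClosed C) (hH : H.Normal)
    (hK : K.Normal) {ψ : MulAut ↥(H ⊓ K)} (hψ : IsRestrictionToL H K φ ψ)
    (hV : C (frakV H K ψ)) {Q : Subgroup B} (hQ : inCStar C B Q)
    (hQ1 : ∀ x ∈ H ⊔ K, x ∈ Q → x = 1) {N₁ : Subgroup (HNNExtension B H K φ)}
    (hN₁ : inCStar C _ N₁) (h₁ : ∀ b, of b ∈ N₁ → b ∈ H ⊓ K ⊔ Q) :
    ∃ N : Subgroup (HNNExtension B H K φ), inCStar C _ N ∧ ∀ b, of b ∈ N → b ∈ Q := by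
  obtain ⟨hQn, hCQ⟩ := hQ
  obtain ⟨hN₁n, hCN₁⟩ := hN₁
  have hLS : H ⊓ K ≤ H ⊔ K := inf_le_left.trans le_sup_left
  have hLn : (H ⊓ K).Normal := inferInstance
  have hLC : C ↥(H ⊓ K) := by
    refine hC.of_injective ((QuotientGroup.mk' Q).comp (H ⊓ K).subtype) ?_ hCQ
    refine (injective_iff_map_eq_one _).2 fun x hx => Subtype.ext ?_
    exact hQ1 x (hLS x.2) ((QuotientGroup.eq_one_iff _).1 hx)
  obtain ⟨M, _, θ, hM, hθ, hθV⟩ := hC.exists_hom_realizing hquot hLC (frakV H K ψ) hV ⊥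
    fun α _ a ha => by rw [Subgroup.mem_bot] at ha ⊢; rw [ha, map_one]
  let f := QuotientGroup.mk' N₁
  have hf : ∀ b, f (of b) = 1 → b ∈ H ⊓ K ⊔ Q := fun b hb =>
    h₁ b ((QuotientGroup.eq_one_iff _).1 hb)
  obtain ⟨j, hj, hj1⟩ := exists_hom_extending (H ⊓ K) Q (f.comp of).ker (fun b hb => hf b hb) θ
    fun a => by
      rw [hθ, Subgroup.mem_bot]
      exact ⟨fun h => by simp [h], fun h => Subtype.ext (hQ1 a (hLS a.2) h)⟩
  refine exists_inCStar_of_compatible hC hCN₁ hM f (fun _ => j) (fun _ _ => rfl)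
    (fun _ b b' => ?_) 1 Q hj1
  let α : MulAut ↥(H ⊓ K) := MulAut.conjNormal b' * ψ * (MulAut.conjNormal b)⁻¹
  have hα : α ∈ frakV H K ψ := mul_mem (mul_mem
    (le_sup_left (a := autOf B (H ⊓ K)) (conjNormal_mem_autOf hLn b'))
    (le_sup_right (a := autOf B (H ⊓ K)) (Subgroup.mem_zpowers ψ)))
    (le_sup_left (a := autOf B (H ⊓ K)) (inv_mem (conjNormal_mem_autOf hLn b)))
  obtain ⟨m, hmα⟩ := hθV α hα
  refine ⟨m, fun h x y hh hx hy => ?_⟩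
  have hhL : (h : B) ∈ H ⊓ K := mem_of_mem_sup hQ1 hLS (le_sup_left (a := H) h.2) (hf h hh)
  have hψh : ((ψ ⟨h, hhL⟩ : ↥(H ⊓ K)) : B) = φ h := hψ ⟨h, hhL⟩
  have hy' : j y = θ (MulAut.conjNormal b' (ψ ⟨h, hhL⟩)) :=
    hj y (MulAut.conjNormal b' (ψ ⟨h, hhL⟩)) (by simp [hy, hψh, mul_assoc])
  have hx' : j x = θ (MulAut.conjNormal b ⟨h, hhL⟩) :=
    hj x (MulAut.conjNormal b ⟨h, hhL⟩) (by simp [hx, mul_assoc])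
  have hα' : α (MulAut.conjNormal b ⟨h, hhL⟩) = MulAut.conjNormal b' (ψ ⟨h, hhL⟩) := by
    simp only [α, MulAut.mul_apply, MulAut.inv_apply_self]
  rw [hy', hx', ← hα', hmα]

/-- If a `C`-quotient of the HNN-extension is faithful on `H K`, then the HNN-extension inherits
residual `C`-ness from the base group. -/
theorem residually_of_faithful_on_sup (hC : IsRootClass C) (hquot : QuotClosed C) (hH : H.Normal)
    (hK : K.Normal) [Finite ↥(H ⊔ K)] (hB : Residually C B)
    {N : Subgroup (HNNExtension B H K φ)} (hN : inCStar C _ N)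
    (hN1 : ∀ b ∈ H ⊔ K, of b ∈ N → b = 1) : Residually C (HNNExtension B H K φ) := by
  have hout : ∀ b ∉ H ⊔ K, ∃ N : Subgroup (HNNExtension B H K φ), inCStar C _ N ∧
      ∀ a ∈ H ⊔ K, of (b * a) ∉ N := by
    intro b hb
    obtain ⟨Q, ⟨hQn, hCQ⟩, hQ⟩ := hB.exists_avoiding hC ((fun a => a * b) '' (H ⊔ K : Subgroup B))
      (Set.Finite.image _ (Set.toFinite _)) (by
        rintro ⟨a, ha, h⟩
        exact hb (by rw [← inv_eq_of_mul_eq_one_right h]; exact inv_mem ha))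
    let S := H ⊔ K ⊔ Q
    have hS : C (B ⧸ S) := hC.quotient_of_le hquot (le_sup_right : Q ≤ S) hCQ
    have hSA : ∀ a ∈ H ⊔ K, QuotientGroup.mk' S a = 1 := fun a ha =>
      (QuotientGroup.eq_one_iff _).2 ((le_sup_left : H ⊔ K ≤ S) ha)
    let f : HNNExtension B H K φ →* B ⧸ S := lift (QuotientGroup.mk' S) 1 fun h => by
      rw [hSA _ (le_sup_left (a := H) h.2), hSA _ (le_sup_right (a := H) (φ h).2)]
    refine ⟨f.ker, hC.inCStar_ker f hS, fun a ha hba => ?_⟩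
    rw [MonoidHom.mem_ker, lift_of, map_mul, hSA a ha, mul_one, QuotientGroup.mk'_apply,
      QuotientGroup.eq_one_iff] at hba
    have hb' : b ∈ ((H ⊔ K ⊔ Q : Subgroup B) : Set B) := hba
    rw [Subgroup.mul_normal] at hb'
    obtain ⟨c, hc, q, hq, rfl⟩ := hb'
    exact hQ _ ⟨c⁻¹, inv_mem hc, rfl⟩ (by simpa using hq)
  refine residually_of_separated hC (fun b hb => ?_) fun v b hb => ?_
  · by_cases hbA : b ∈ H ⊔ K
    · exact ⟨N, hN, fun h => hb (hN1 b hbA h)⟩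
    · obtain ⟨N', hN', h⟩ := hout b hbA
      exact ⟨N', hN', by simpa using h 1 (one_mem _)⟩
  · have hle : toSubgroup H K v ≤ H ⊔ K := by
      rcases Int.units_eq_one_or v with rfl | rfl
      · exact le_sup_left
      · exact le_sup_right
    by_cases hbA : b ∈ H ⊔ K
    · refine ⟨N, hN, fun a ha h => hb ?_⟩
      rw [eq_inv_of_mul_eq_one_left (hN1 _ (mul_mem hbA (hle ha)) h)]
      exact inv_mem ha
    · obtain ⟨N', hN', h⟩ := hout b hbA
      exact ⟨N', hN', fun a ha => h a (hle ha)⟩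

/-- The automorphisms of `A` which become conjugations in `G`. -/
def MonoidHom.conjRealizable {A G : Type*} [Group A] [Group G] (e : A →* G) :
    Subgroup (MulAut A) where
  carrier := { α | ∃ g : G, ∀ a, e (α a) = g * e a * g⁻¹ }
  one_mem' := ⟨1, fun a => by simp⟩
  mul_mem' := by
    rintro α β ⟨g, hg⟩ ⟨k, hk⟩
    exact ⟨g * k, fun a => by rw [MulAut.mul_apply, hg, hk]; group⟩
  inv_mem' := by
    rintro α ⟨g, hg⟩
    refine ⟨g⁻¹, fun a => ?_⟩
    have h := hg (α⁻¹ a)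
    rw [MulAut.apply_inv_self] at h
    rw [h]
    group

theorem Residually.mulAut_of_conj (hC : IsRootClass C) (hquot : QuotClosed C)
    {A E : Type u} [Group A] [Finite A] [Group E] (hE : Residually C E) (e : A →* E)
    (he : Function.Injective e) (V : Subgroup (MulAut A)) (hV : V ≤ e.conjRealizable) : C V := by
  have : Finite e.range := Finite.of_surjective e.rangeRestrict e.rangeRestrict_surjective
  obtain ⟨N, ⟨hN, hCN⟩, h⟩ := hE.exists_inf_eq_bot hC e.range
  refine hC.mulAut_of_conj hquot ((QuotientGroup.mk' N).comp e) ?_ hCN V fun α hα => ?_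
  · refine (injective_iff_map_eq_one _).2 fun a ha => he ?_
    rw [map_one]
    exact h _ ⟨a, rfl⟩ ((QuotientGroup.eq_one_iff _).1 ha)
  · obtain ⟨g, hg⟩ := hV hα
    exact ⟨QuotientGroup.mk' N g, fun a => by
      simp only [MonoidHom.comp_apply, hg, map_mul, map_inv]⟩

theorem frakU_le_conjRealizable :
    frakU H K φ ≤ ((of : B →* HNNExtension B H K φ).comp H.subtype).conjRealizable := by
  refine sup_le ?_ ?_
  · rintro α ⟨b, hb⟩
    exact ⟨of b, fun a => by simp [hb]⟩
  · rintro _ ⟨β, ⟨b, hb⟩, rfl⟩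
    refine ⟨t⁻¹ * of b * t, fun a => ?_⟩
    have h1 : ((autConjHom φ β a : H) : B) = φ.symm (β (φ a)) := rfl
    have h2 : (of (a : B) : HNNExtension B H K φ) = t⁻¹ * of (φ a : B) * t := by
      rw [equiv_eq_conj]; group
    simp only [MonoidHom.comp_apply, Subgroup.subtype_apply, h1]
    rw [equiv_symm_eq_conj, hb, h2, map_mul, map_mul, map_inv]
    group

theorem frakV_le_conjRealizable {ψ : MulAut ↥(H ⊓ K)} (hψ : IsRestrictionToL H K φ ψ) :
    frakV H K ψ ≤
      ((of : B →* HNNExtension B H K φ).comp (H ⊓ K).subtype).conjRealizable := by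
  refine sup_le ?_ (Subgroup.zpowers_le.2 ⟨t, fun a => ?_⟩)
  · rintro α ⟨b, hb⟩
    exact ⟨of b, fun a => by simp [hb]⟩
  · simp only [MonoidHom.comp_apply, Subgroup.subtype_apply, hψ a]
    rw [equiv_eq_conj]

end AssociatedSubgroups

theorem statement_2 (C : GroupClass.{u}) (hroot : IsRootClass C) (hquot : QuotClosed C)
    {B : Type u} [Group B] (H K : Subgroup B) (φ : H ≃* K)
    (hH : H.Normal) (hK : K.Normal)
    (ψ : MulAut ↥(H ⊓ K)) (hψ : IsRestrictionToL H K φ ψ)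
    (hHfin : Finite H) (hKfin : Finite K) :
    Residually C (HNNExtension B H K φ) ↔
      (Residually C B ∧ C ↥(frakU H K φ) ∧ C ↥(frakV H K ψ)) := by
  have hofinj : Function.Injective (HNNExtension.of : B →* HNNExtension B H K φ) :=
    HNNExtension.of_injective φ
  have hLfin : Finite ↥(H ⊓ K) :=
    Finite.of_injective _ (Subgroup.inclusion_injective (inf_le_left : H ⊓ K ≤ H))
  constructor
  · intro hE
    exact ⟨hE.of_injective hroot _ hofinj,
      hE.mulAut_of_conj hroot hquot (HNNExtension.of.comp H.subtype)
        (hofinj.comp H.subtype_injective) _ frakU_le_conjRealizable,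
      hE.mulAut_of_conj hroot hquot (HNNExtension.of.comp (H ⊓ K).subtype)
        (hofinj.comp (H ⊓ K).subtype_injective) _ (frakV_le_conjRealizable hψ)⟩
  · rintro ⟨hB, hU, hV⟩
    have hfin : Finite ↥(H ⊔ K) := by
      have h : ((H ⊔ K : Subgroup B) : Set B).Finite := by
        rw [Subgroup.mul_normal]
        exact Set.Finite.mul (Set.toFinite _) (Set.toFinite _)
      exact h.to_subtype
    obtain ⟨Q, hQ, hQ1⟩ := hB.exists_inf_eq_bot hroot (H ⊔ K)
    obtain ⟨N₁, hN₁, h₁⟩ := exists_inCStar_le_inf_sup hroot hquot hH hK hψ hU hQ hQ1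
    obtain ⟨N, hN, h⟩ := exists_inCStar_le_of_inf_sup hroot hquot hH hK hψ hV hQ hQ1 hN₁ h₁
    exact residually_of_faithful_on_sup hroot hquot hH hK hB hN fun b hb hbN => hQ1 b hb (h b hbN)
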